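/- For a G-invariant finite MDP, the Bellman optimality operator commutes with the induced group action on Q-functions: for every g ∈ G and every Q : S → A → ℝ, defining Q^g(s, a) := Q(g • s, g • a), one has T(Q^g) = (T Q)^g. -/

import Mathlib

open Finset

/-- The Bellman optimality operator:
`(T Q)(s, a) = r(s, a) + γ · ∑_{s'} p(s, a, s') · (max_{a'} Q(s', a'))`. -/
noncomputable def bellman {S A : Type*} [Fintype S] [Fintype A] [Nonempty A]
    (p : S → A → S → ℝ) (r : S → A → ℝ) (γ : ℝ)
    (Q : S → A → ℝ) : S → A → ℝ :=
  fun s a =>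
    r s a + γ * ∑ s', p s a s' * (univ.sup' univ_nonempty (fun a' => Q s' a'))

/-- For a `G`-invariant finite MDP, the Bellman optimality operator commutes
with the induced group action on Q-functions: `T (Q^g) = (T Q)^g` where
`Q^g (s, a) = Q (g • s, g • a)`. -/
theorem bellman_comm_group_action
    {G S A : Type*} [Group G]
    [Fintype S] [Fintype A] [Nonempty S] [Nonempty A]
    [MulAction G S] [MulAction G A]
    (p : S → A → S → ℝ) (r : S → A → ℝ) (γ : ℝ)
    (hp_nonneg : ∀ s a s', 0 ≤ p s a s')
    (hp_sum : ∀ s a, ∑ s', p s a s' = 1)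
    (hγ0 : 0 ≤ γ) (hγ1 : γ < 1)
    (hp_inv : ∀ (g : G) (s : S) (a : A) (s' : S),
      p (g • s) (g • a) (g • s') = p s a s')
    (hr_inv : ∀ (g : G) (s : S) (a : A), r (g • s) (g • a) = r s a)
    (g : G) (Q : S → A → ℝ) :
    bellman p r γ (fun s a => Q (g • s) (g • a)) =
      fun s a => bellman p r γ Q (g • s) (g • a) := by
  have hsup : ∀ f : A → ℝ, univ.sup' univ_nonempty (fun a => f (g • a)) =
      univ.sup' univ_nonempty f := by
    intro f
    apply le_antisymm
    · exact Finset.sup'_le _ _ fun a _ => Finset.le_sup' f (mem_univ (g • a))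
    · refine Finset.sup'_le _ _ fun a _ => ?_
      have h := Finset.le_sup' (fun a => f (g • a)) (mem_univ (g⁻¹ • a))
      simpa only [smul_inv_smul] using h
  funext s a
  simp only [bellman]
  rw [hr_inv, ← Equiv.sum_comp (MulAction.toPerm g)
    (fun s' => p (g • s) (g • a) s' * univ.sup' univ_nonempty (fun a' => Q s' a'))]
  congr 2
  refine Finset.sum_congr rfl fun s' _ => ?_
  rw [MulAction.toPerm_apply, hp_inv, hsup (fun a' => Q (g • s') a')]
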